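/- For every integer n, the product w_n = T^n A T^{-n} B T^n A^{-1} T^{-n} B^{-1} is the identity automorphism of the free group F₃. -/

import Mathlib

/-- The free group on three generators. -/
abbrev F₃ : Type := FreeGroup (Fin 3)

/-- The generators of `F₃`. -/
abbrev x (i : Fin 3) : F₃ := FreeGroup.of i

/-- A subgroup mapped into itself by an automorphism and by its inverse is mapped into itself
by every integer power of that automorphism. -/
theorem MulAut.zpow_apply_mem {G : Type*} [Group G] {H : Subgroup G} {T : MulAut G}
    (hT : ∀ g ∈ H, T g ∈ H) (hT' : ∀ g ∈ H, T⁻¹ g ∈ H) (n : ℤ) : ∀ g ∈ H, (T ^ n) g ∈ H := by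
  induction n with
  | zero => simp
  | succ k ih =>
    intro g hg
    rw [zpow_add_one, MulAut.mul_apply]
    exact ih _ (hT g hg)
  | pred k ih =>
    intro g hg
    rw [zpow_sub_one, MulAut.mul_apply]
    exact ih _ (hT' g hg)

/-- An automorphism fixing `x 0` and `x 1` fixes the subgroup they generate pointwise. -/
theorem apply_eq_self_of_mem_closure {A : MulAut F₃} (hA0 : A (x 0) = x 0) (hA1 : A (x 1) = x 1)
    {g : F₃} (hg : g ∈ Subgroup.closure {x 0, x 1}) : A g = g := by
  have h : Set.EqOn A.toMonoidHom (MonoidHom.id F₃) {x 0, x 1} := by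
    rintro y (rfl | rfl)
    · exact hA0
    · exact hA1
  exact MonoidHom.eqOn_closure h hg

/-- An automorphism maps the subgroup generated by `x 0` and `x 1` into any subgroup containing
the images of `x 0` and `x 1`. -/
theorem apply_mem_of_mem_closure {T : MulAut F₃} {H : Subgroup F₃} (h0 : T (x 0) ∈ H)
    (h1 : T (x 1) ∈ H) : ∀ g ∈ Subgroup.closure {x 0, x 1}, T g ∈ H := by
  have h : Subgroup.closure {x 0, x 1} ≤ H.comap T.toMonoidHom := by
    rw [Subgroup.closure_le]
    rintro y (rfl | rfl)
    · exact h0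
    · exact h1
  exact fun g hg => h hg

/-- Let `T, A, B ∈ Aut(F₃)` be the automorphisms determined on the generators by
`T : x₀ ↦ x₀²x₁, x₁ ↦ x₀x₁, x₂ ↦ x₂`, `A : x₀ ↦ x₀, x₁ ↦ x₁, x₂ ↦ x₀x₂` and
`B : x₀ ↦ x₀, x₁ ↦ x₁, x₂ ↦ x₂x₁`.  Then for every integer `n`, the word
`wₙ = Tⁿ A T⁻ⁿ B Tⁿ A⁻¹ T⁻ⁿ B⁻¹` is the identity automorphism of `F₃`. -/
theorem w_n_trivial (T A B : MulAut F₃)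
    (hT0 : T (x 0) = x 0 * x 0 * x 1) (hT1 : T (x 1) = x 0 * x 1) (hT2 : T (x 2) = x 2)
    (hA0 : A (x 0) = x 0) (hA1 : A (x 1) = x 1) (hA2 : A (x 2) = x 0 * x 2)
    (hB0 : B (x 0) = x 0) (hB1 : B (x 1) = x 1) (hB2 : B (x 2) = x 2 * x 1) :
    ∀ n : ℤ,
      T ^ n * A * T ^ (-n) * B * T ^ n * A⁻¹ * T ^ (-n) * B⁻¹ = 1 := by
  intro n
  set K : Subgroup F₃ := Subgroup.closure {x 0, x 1}
  have h0 : x 0 ∈ K := Subgroup.subset_closure (by simp)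
  have h1 : x 1 ∈ K := Subgroup.subset_closure (by simp)
  have hT'0 : T⁻¹ (x 0) = x 0 * (x 1)⁻¹ := by
    rw [MulAut.inv_apply, MulEquiv.symm_apply_eq, map_mul, map_inv, hT0, hT1]
    group
  have hT'1 : T⁻¹ (x 1) = x 1 * (x 0)⁻¹ * x 1 := by
    rw [MulAut.inv_apply, MulEquiv.symm_apply_eq, map_mul, map_mul, map_inv, hT0, hT1]
    group
  have hTK : ∀ m : ℤ, ∀ g ∈ K, (T ^ m) g ∈ K :=
    MulAut.zpow_apply_mem
      (apply_mem_of_mem_closure (hT0 ▸ K.mul_mem (K.mul_mem h0 h0) h1)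
        (hT1 ▸ K.mul_mem h0 h1))
      (apply_mem_of_mem_closure (hT'0 ▸ K.mul_mem h0 (K.inv_mem h1))
        (hT'1 ▸ K.mul_mem (K.mul_mem h1 (K.inv_mem h0)) h1))
  have hT2' (m : ℤ) : (T ^ m) (x 2) = x 2 :=
    (MulAction.stabilizer (MulAut F₃) (x 2)).zpow_mem (x := T) hT2 m
  have hA : ∀ g ∈ K, A g = g := fun g hg => apply_eq_self_of_mem_closure hA0 hA1 hg
  have hB : ∀ g ∈ K, B g = g := fun g hg => apply_eq_self_of_mem_closure hB0 hB1 hg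
  have hC : ∀ g ∈ K, (T ^ n * A * T ^ (-n)) g = g := by
    intro g hg
    rw [MulAut.mul_apply, MulAut.mul_apply, hA _ (hTK _ g hg), ← MulAut.mul_apply, ← zpow_add]
    simp
  have hC2 : (T ^ n * A * T ^ (-n)) (x 2) = (T ^ n) (x 0) * x 2 := by
    rw [MulAut.mul_apply, MulAut.mul_apply, hT2', hA2, map_mul, hT2']
  have hcomm : T ^ n * A * T ^ (-n) * B = B * (T ^ n * A * T ^ (-n)) := by
    have on_K : ∀ g ∈ K, (T ^ n * A * T ^ (-n) * B) g = (B * (T ^ n * A * T ^ (-n))) g := by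
      intro g hg
      rw [MulAut.mul_apply _ _ B, MulAut.mul_apply _ B, hB g hg, hC g hg, hB g hg]
    apply MulEquiv.toMonoidHom_injective
    refine FreeGroup.ext_hom _ _ fun i => ?_
    fin_cases i
    · exact on_K _ h0
    · exact on_K _ h1
    · change (T ^ n * A * T ^ (-n) * B) (x 2) = (B * (T ^ n * A * T ^ (-n))) (x 2)
      rw [MulAut.mul_apply _ _ B, MulAut.mul_apply _ B, hB2, map_mul, hC2, hC _ h1, map_mul,
        hB _ (hTK n _ h0), hB2, mul_assoc]
  rw [hcomm]
  group
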